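/- arXiv:0708.0934 — 3 statements merged into one kernel-verified Lean document; each statement's English description precedes it below -/
import Mathlib

section
/- Functional equations for the hyperbolic gamma function: for ω₊, ω₋ ∈ ℂ₊ and z ∈ ℂ with |Im z| < Re(ω₋)/2 one has G(z+iω₊/2) = 2 cosh(πz/ω₋) · G(z−iω₊/2), and for z with |Im z| < Re(ω₊)/2 one has G(z+iω₋/2) = 2 cosh(πz/ω₊) · G(z−iω₋/2), where G = G(ω₊,ω₋;·). -/
open MeasureTheory Set
open scoped BigOperators Classical

noncomputable section

/-- Ruijsenaars' hyperbolic gamma function `G(ω₊,ω₋;z)`, defined by the integral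
representation, valid on the strip `|Im z| < Re((ω₊+ω₋)/2)`. -/
def hypGammaInt (op om z : ℂ) : ℂ :=
  Complex.exp (Complex.I * ∫ y in Set.Ioi (0:ℝ),
    (1/(y:ℂ)) * (Complex.sin (2*(y:ℂ)*z) /
        (2 * Complex.sinh (op*(y:ℂ)) * Complex.sinh (om*(y:ℂ)))
      - z/(op*om*(y:ℂ))))


section HypGammaAux

open Filter Topology Asymptotics

lemma real_sinh_re_le_norm_sinh (w : ℂ) : Real.sinh w.re ≤ ‖Complex.sinh w‖ := by
  have h := norm_sub_norm_le (Complex.exp w) (Complex.exp (-w))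
  rw [Complex.norm_exp, Complex.norm_exp, Complex.neg_re] at h
  rw [Complex.sinh, norm_div, Real.sinh_eq, Complex.norm_ofNat]
  linarith

lemma sinh_mul_ofReal_ne_zero {a : ℂ} (ha : 0 < a.re) {y : ℝ} (hy : 0 < y) :
    Complex.sinh (a * y) ≠ 0 := by
  have h := real_sinh_re_le_norm_sinh (a * y)
  have h' : 0 < Real.sinh (a * y).re := by
    rw [Real.sinh_pos_iff, Complex.re_mul_ofReal]
    positivity
  exact norm_pos_iff.mp (h'.trans_le h)

lemma ne_zero_of_pos_re {a : ℂ} (ha : 0 < a.re) : a ≠ 0 := by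
  rintro rfl
  simp at ha

lemma inv_sinh_isBigO_atTop {a : ℂ} (ha : 0 < a.re) :
    (fun y : ℝ => (Complex.sinh (a * y))⁻¹) =O[atTop] fun y => Real.exp (-a.re * y) := by
  refine IsBigO.of_bound 4 ?_
  filter_upwards [eventually_ge_atTop (1 / a.re), eventually_gt_atTop 0] with y hy hy0
  have h := real_sinh_re_le_norm_sinh (a * y)
  rw [Complex.re_mul_ofReal, Real.sinh_eq] at h
  have h1 : 1 ≤ a.re * y := by
    rw [div_le_iff₀ ha] at hy
    linarith
  have h2 : Real.exp (a.re * y) / 4 ≤ ‖Complex.sinh (a * y)‖ := by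
    have h3 := Real.add_one_le_exp (a.re * y)
    have h4 : Real.exp (-(a.re * y)) * Real.exp (a.re * y) = 1 := by
      rw [← Real.exp_add]; simp
    have h5 := Real.exp_pos (-(a.re * y))
    nlinarith
  rw [norm_inv, Real.norm_of_nonneg (Real.exp_pos _).le, neg_mul, Real.exp_neg]
  rw [show 4 * (Real.exp (a.re * y))⁻¹ = (Real.exp (a.re * y) / 4)⁻¹ by field_simp]
  exact inv_anti₀ (by positivity) h2

lemma norm_sin_le_exp (w : ℂ) : ‖Complex.sin w‖ ≤ Real.exp |w.im| := by
  have h1 : ‖Complex.exp (-w * Complex.I)‖ ≤ Real.exp |w.im| := by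
    rw [Complex.norm_exp]
    simpa using le_abs_self w.im
  have h2 : ‖Complex.exp (w * Complex.I)‖ ≤ Real.exp |w.im| := by
    rw [Complex.norm_exp]
    simpa using neg_le_abs w.im
  rw [Complex.sin, norm_div, norm_mul, Complex.norm_I, mul_one, Complex.norm_ofNat]
  have := norm_sub_le (Complex.exp (-w * Complex.I)) (Complex.exp (w * Complex.I))
  linarith

lemma sinh_sub_self_isBigO : (fun w : ℂ => Complex.sinh w - w) =O[𝓝 0] fun w => w ^ 3 := by
  have h1 := Complex.exp_sub_sum_range_isBigO_pow 3
  have h2 := h1.comp_tendsto (k := fun w : ℂ => -w) (l' := 𝓝 0)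
    (by simpa using (continuous_neg (G := ℂ)).tendsto 0)
  have h3 : ((fun w : ℂ => w ^ 3) ∘ fun w : ℂ => -w) =O[𝓝 0] fun w : ℂ => w ^ 3 :=
    IsBigO.of_bound 1 (by simp)
  refine ((h1.sub (h2.trans h3)).const_mul_left (1 / 2)).congr_left fun w => ?_
  simp [Finset.sum_range_succ, Complex.sinh]
  ring

lemma sinh_mul_sub_isBigO (a : ℂ) :
    (fun y : ℝ => Complex.sinh (a * y) - a * y) =O[𝓝[>] 0] fun y : ℝ => y ^ 3 := by
  have ht : Tendsto (fun y : ℝ => a * (y : ℂ)) (𝓝[>] 0) (𝓝 0) := by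
    have : Continuous fun y : ℝ => a * (y : ℂ) := by fun_prop
    simpa using (this.tendsto 0).mono_left nhdsWithin_le_nhds
  refine (sinh_sub_self_isBigO.comp_tendsto ht).trans (IsBigO.of_bound (‖a‖ ^ 3) ?_)
  filter_upwards with y
  simp [mul_pow]

lemma inv_sinh_isBigO_zero {a : ℂ} (ha : a ≠ 0) :
    (fun y : ℝ => (Complex.sinh (a * y))⁻¹) =O[𝓝[>] 0] fun y : ℝ => y⁻¹ := by
  have h0 : (fun y : ℝ => y ^ 3) =o[𝓝[>] (0 : ℝ)] fun y : ℝ => a * (y : ℂ) := by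
    have h1 : (fun y : ℝ => y ^ 3) =o[𝓝 (0 : ℝ)] fun y : ℝ => y ^ 1 :=
      isLittleO_pow_pow (by norm_num)
    refine (h1.mono nhdsWithin_le_nhds).trans_isBigO (IsBigO.of_bound ‖a‖⁻¹ ?_)
    filter_upwards with y
    simp [ha]
  have h2 : IsEquivalent (𝓝[>] 0) (fun y : ℝ => Complex.sinh (a * y)) (fun y : ℝ => a * (y : ℂ)) :=
    (sinh_mul_sub_isBigO a).trans_isLittleO h0
  refine h2.inv.isBigO.trans (IsBigO.of_bound ‖a‖⁻¹ ?_)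
  filter_upwards with y
  simp [mul_comm]

/-- The integrand of the integral representation is integrable on `(0, ∞)`. -/
lemma hypGammaInt_integrableOn {op om z : ℂ} (hop : 0 < op.re) (hom : 0 < om.re)
    (hz : |z.im| < (op.re + om.re) / 2) :
    IntegrableOn (fun y : ℝ => (1/(y:ℂ)) * (Complex.sin (2*(y:ℂ)*z) /
        (2 * Complex.sinh (op*(y:ℂ)) * Complex.sinh (om*(y:ℂ)))
      - z/(op*om*(y:ℂ)))) (Ioi 0) := by
  have hop0 := ne_zero_of_pos_re hop
  have hom0 := ne_zero_of_pos_re hom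
  set f := fun y : ℝ => (1/(y:ℂ)) * (Complex.sin (2*(y:ℂ)*z) /
        (2 * Complex.sinh (op*(y:ℂ)) * Complex.sinh (om*(y:ℂ)))
      - z/(op*om*(y:ℂ))) with hf
  have hcont : ContinuousOn f (Ioi 0) := by
    intro y hy
    have hy : 0 < y := hy
    have hyc : (y : ℂ) ≠ 0 := by exact_mod_cast hy.ne'
    have h1 := sinh_mul_ofReal_ne_zero hop hy
    have h2 := sinh_mul_ofReal_ne_zero hom hy
    apply ContinuousAt.continuousWithinAt
    have e1 : ContinuousAt (fun y : ℝ => (y : ℂ)) y := by fun_prop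
    have e2 : ContinuousAt (fun y : ℝ => Complex.sinh (op * (y : ℂ))) y := by fun_prop
    have e3 : ContinuousAt (fun y : ℝ => Complex.sinh (om * (y : ℂ))) y := by fun_prop
    have e4 : ContinuousAt (fun y : ℝ => Complex.sin (2*(y:ℂ)*z)) y := by fun_prop
    exact (continuousAt_const.div e1 hyc).mul ((e4.div ((continuousAt_const.mul e2).mul e3)
      (by simp [h1, h2])).sub (continuousAt_const.div (continuousAt_const.mul e1)
      (by simp [hop0, hom0, hyc])))
  have hinv : (fun y : ℝ => 1 / (y : ℂ)) =O[atTop] fun y : ℝ => y ^ (-1 : ℝ) := by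
    refine IsBigO.of_bound 1 ?_
    filter_upwards with y
    simp [Real.rpow_neg_one]
  have htop : f =O[atTop] fun y : ℝ => y ^ (-2 : ℝ) := by
    have hsin : (fun y : ℝ => Complex.sin (2*(y:ℂ)*z)) =O[atTop]
        fun y : ℝ => Real.exp (2 * |z.im| * y) := by
      refine IsBigO.of_bound 1 ?_
      filter_upwards [eventually_gt_atTop 0] with y hy
      rw [one_mul, Real.norm_of_nonneg (Real.exp_pos _).le]
      refine (norm_sin_le_exp _).trans_eq ?_
      congr 1
      rw [show (2*(y:ℂ)*z).im = 2 * y * z.im by simp, abs_mul, abs_of_pos (by positivity)]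
      ring
    have h1 := (hsin.mul ((inv_sinh_isBigO_atTop hop).mul
      (inv_sinh_isBigO_atTop hom))).const_mul_left (1 / 2)
    have h2 : (fun y : ℝ => Complex.sin (2*(y:ℂ)*z) /
        (2 * Complex.sinh (op*(y:ℂ)) * Complex.sinh (om*(y:ℂ)))) =O[atTop]
        fun y : ℝ => y ^ (-1 : ℝ) := by
      refine IsBigO.trans ?_ (isLittleO_exp_neg_mul_rpow_atTop
        (a := op.re + om.re - 2 * |z.im|) (by linarith) (-1)).isBigO
      refine h1.congr (fun y => ?_) fun y => ?_
      · simp only [div_eq_mul_inv, mul_inv]; ring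
      · rw [← Real.exp_add, ← Real.exp_add]; congr 1; ring
    have h3 : (fun y : ℝ => z/(op*om*(y:ℂ))) =O[atTop] fun y : ℝ => y ^ (-1 : ℝ) := by
      refine (hinv.const_mul_left (z / (op * om))).congr_left fun y => ?_
      rw [div_mul_div_comm, mul_one]
    refine (hinv.mul (h2.sub h3)).congr' (by rfl) ?_
    filter_upwards [eventually_gt_atTop 0] with y hy
    rw [← Real.rpow_add hy]; norm_num
  have hbot : f =O[𝓝[>] 0] fun y : ℝ => y ^ (-0 : ℝ) := by
    have hs := (sinh_mul_sub_isBigO (2 * z * Complex.I)).const_mul_left (-Complex.I)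
    have hi := (inv_sinh_isBigO_zero hop0).mul (inv_sinh_isBigO_zero hom0)
    have hy1 : (fun y : ℝ => (y : ℂ)) =O[𝓝[>] 0] fun y : ℝ => y :=
      IsBigO.of_bound 1 (by simp)
    have hyi : (fun y : ℝ => (y : ℂ)⁻¹) =O[𝓝[>] 0] fun y : ℝ => y⁻¹ :=
      IsBigO.of_bound 1 (by simp)
    have hsm : (fun y : ℝ => Complex.sinh (om * y)) =O[𝓝[>] 0] fun y : ℝ => y := by
      have h3 : (fun y : ℝ => y ^ 3) =O[𝓝[>] (0 : ℝ)] fun y : ℝ => y := by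
        have : (fun y : ℝ => y ^ 3) =o[𝓝 (0 : ℝ)] fun y : ℝ => y ^ 1 :=
          isLittleO_pow_pow (by norm_num)
        simpa using this.isBigO.mono nhdsWithin_le_nhds
      refine (((sinh_mul_sub_isBigO om).trans h3).add (hy1.const_mul_left om)).congr_left ?_
      intro y; ring
    have hP := ((sinh_mul_sub_isBigO op).mul hsm).add
      (((sinh_mul_sub_isBigO om).mul hy1).const_mul_left op)
    have hfirst := ((hyi.mul (hs.mul hi)).const_mul_left (1 / 2))
    have hsecond := ((hyi.mul ((hP.mul hi).mul hyi)).const_mul_left (-z / (op * om)))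
    have hg : (fun y : ℝ => y⁻¹ * (y ^ 3 * (y⁻¹ * y⁻¹))) =ᶠ[𝓝[>] 0]
        fun y : ℝ => y ^ (-0 : ℝ) := by
      filter_upwards [self_mem_nhdsWithin] with y hy
      have hy : y ≠ 0 := ne_of_gt hy
      rw [neg_zero, Real.rpow_zero]; field_simp
    have hg' : (fun y : ℝ => y⁻¹ * (y ^ 3 * y * (y⁻¹ * y⁻¹) * y⁻¹)) =ᶠ[𝓝[>] 0]
        fun y : ℝ => y ^ (-0 : ℝ) := by
      filter_upwards [self_mem_nhdsWithin] with y hy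
      have hy : y ≠ 0 := ne_of_gt hy
      rw [neg_zero, Real.rpow_zero]; field_simp
    refine ((hfirst.congr' (by rfl) hg).add (hsecond.congr' (by rfl) hg')).congr' ?_ (by rfl)
    filter_upwards [self_mem_nhdsWithin] with y hy
    have hyc : (y : ℂ) ≠ 0 := by
      have : y ≠ 0 := ne_of_gt hy
      exact_mod_cast this
    have h1 := sinh_mul_ofReal_ne_zero hop hy
    have h2 := sinh_mul_ofReal_ne_zero hom hy
    have h3 : Complex.sin (2*(y:ℂ)*z) = -Complex.I * Complex.sinh (2 * z * Complex.I * y) := by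
      rw [show 2 * z * Complex.I * y = (2*(y:ℂ)*z) * Complex.I by ring, Complex.sinh_mul_I]
      linear_combination (Complex.sin (2*(y:ℂ)*z)) * Complex.I_sq
    have h4 : -Complex.I * (Complex.sinh (2 * z * Complex.I * y) - 2 * z * Complex.I * y)
        = Complex.sin (2*(y:ℂ)*z) - 2 * y * z := by
      rw [h3]; linear_combination (2 * z * y) * Complex.I_sq
    rw [hf]
    simp only [h4]
    generalize Complex.sinh (op * y) = A at h1 ⊢
    generalize Complex.sinh (om * y) = B at h2 ⊢
    generalize Complex.sin (2 * y * z) = S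
    field_simp
    ring
  have hm : MellinConvergent f 1 :=
    mellinConvergent_of_isBigO_rpow (hcont.locallyIntegrableOn measurableSet_Ioi) htop
      (by norm_num) hbot (by norm_num)
  simpa [MellinConvergent] using hm


lemma integrable_exp_segment {p q : ℂ} (hp : 0 < p.re) (hq : 0 < q.re) :
    Integrable (Function.uncurry fun (y t : ℝ) => (q - p) * Complex.exp (-(p + t * (q - p)) * y))
      ((volume.restrict (Ioi 0)).prod (volume.restrict (Ioc 0 1))) := by
  have hm : 0 < min p.re q.re := lt_min hp hq
  have h1 : Integrable (fun y : ℝ => ‖q - p‖ * Real.exp (-(min p.re q.re) * y))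
      (volume.restrict (Ioi 0)) := (exp_neg_integrableOn_Ioi 0 hm).const_mul _
  have h2 : Integrable (fun _ : ℝ => (1 : ℝ)) (volume.restrict (Ioc (0 : ℝ) 1)) := by
    simp
  refine (h1.mul_prod h2).mono' ?_ ?_
  · refine Continuous.aestronglyMeasurable ?_
    simp only [Function.uncurry_def]
    fun_prop
  · rw [Measure.prod_restrict]
    filter_upwards [ae_restrict_mem (measurableSet_Ioi.prod measurableSet_Ioc)] with x hx
    obtain ⟨hy : 0 < x.1, ht0, ht1⟩ := hx
    simp only [Function.uncurry_def, norm_mul, Complex.norm_exp, mul_one]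
    gcongr
    have e : (-(p + (x.2 : ℂ) * (q - p)) * (x.1 : ℂ)).re
        = -((1 - x.2) * p.re + x.2 * q.re) * x.1 := by
      simp only [Complex.re_mul_ofReal, Complex.neg_re, Complex.add_re, Complex.re_ofReal_mul,
        Complex.sub_re]
      ring
    rw [e]
    have h3 : min p.re q.re ≤ (1 - x.2) * p.re + x.2 * q.re := by
      nlinarith [min_le_left p.re q.re, min_le_right p.re q.re]
    nlinarith

lemma integral_exp_segment (p q : ℂ) {y : ℝ} (hy : 0 < y) :
    ∫ t in Ioc (0 : ℝ) 1, (q - p) * Complex.exp (-(p + t * (q - p)) * y)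
      = (Complex.exp (-p * y) - Complex.exp (-q * y)) / y := by
  have hyc : (y : ℂ) ≠ 0 := by exact_mod_cast hy.ne'
  rw [← intervalIntegral.integral_of_le zero_le_one]
  have hd : ∀ t : ℝ, HasDerivAt (fun t : ℝ => -Complex.exp (-(p + t * (q - p)) * y) / y)
      ((q - p) * Complex.exp (-(p + t * (q - p)) * y)) t := by
    intro t
    have h := ((((((hasDerivAt_id (t : ℂ)).mul_const (q - p)).const_add p).neg).mul_const
      (y : ℂ)).cexp.neg.div_const (y : ℂ)).comp_ofReal
    convert! h using 1
    simp
    field_simp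
    ring
  rw [intervalIntegral.integral_eq_sub_of_hasDerivAt (fun t _ => hd t)
    (Continuous.intervalIntegrable (by fun_prop) _ _)]
  simp
  ring

/-- Frullani's integral for complex exponentials. -/
lemma frullani_exp {p q : ℂ} (hp : 0 < p.re) (hq : 0 < q.re) :
    IntegrableOn (fun y : ℝ => (Complex.exp (-p * y) - Complex.exp (-q * y)) / y) (Ioi 0) ∧
    ∫ y in Ioi (0 : ℝ), (Complex.exp (-p * y) - Complex.exp (-q * y)) / y
      = Complex.log q - Complex.log p := by
  have hint := integrable_exp_segment hp hq
  constructor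
  · refine hint.integral_prod_left.congr ?_
    filter_upwards [ae_restrict_mem measurableSet_Ioi] with y hy
    exact integral_exp_segment p q hy
  have hre : ∀ t ∈ Icc (0 : ℝ) 1, 0 < (p + t * (q - p)).re := by
    rintro t ⟨ht0, ht1⟩
    have : (p + t * (q - p)).re = (1 - t) * p.re + t * q.re := by simp; ring
    rw [this]
    rcases ht0.eq_or_lt with rfl | h
    · simpa
    · have := mul_pos h hq
      have := mul_nonneg (sub_nonneg.mpr ht1) hp.le
      linarith
  calc ∫ y in Ioi (0 : ℝ), (Complex.exp (-p * y) - Complex.exp (-q * y)) / y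
      = ∫ y in Ioi (0 : ℝ), ∫ t in Ioc (0 : ℝ) 1,
          (q - p) * Complex.exp (-(p + t * (q - p)) * y) :=
        setIntegral_congr_fun measurableSet_Ioi fun y hy => (integral_exp_segment p q hy).symm
    _ = ∫ t in Ioc (0 : ℝ) 1, ∫ y in Ioi (0 : ℝ),
          (q - p) * Complex.exp (-(p + t * (q - p)) * y) := integral_integral_swap hint
    _ = ∫ t in Ioc (0 : ℝ) 1, (q - p) / (p + t * (q - p)) := by
        refine setIntegral_congr_fun measurableSet_Ioc fun t ht => ?_
        have h := hre t (Ioc_subset_Icc_self ht)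
        have h' : (-(p + t * (q - p))).re < 0 := by
          rw [Complex.neg_re]
          exact neg_lt_zero.mpr h
        rw [integral_const_mul, integral_exp_mul_complex_Ioi h', Complex.ofReal_zero, mul_zero,
          Complex.exp_zero, neg_div_neg_eq, mul_one_div]
    _ = ∫ t in (0 : ℝ)..1, (q - p) / (p + t * (q - p)) :=
        (intervalIntegral.integral_of_le zero_le_one).symm
    _ = Complex.log q - Complex.log p := by
        have hd : ∀ t ∈ uIcc (0 : ℝ) 1, HasDerivAt (fun t : ℝ => Complex.log (p + t * (q - p)))
            ((q - p) / (p + t * (q - p))) t := by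
          intro t ht
          rw [uIcc_of_le zero_le_one] at ht
          have h := (((hasDerivAt_id (t : ℂ)).mul_const (q - p)).const_add p).comp_ofReal.clog_real
            (Or.inl (hre t ht))
          simpa using! h
        rw [intervalIntegral.integral_eq_sub_of_hasDerivAt hd]
        · simp
        · refine ContinuousOn.intervalIntegrable fun t ht => ?_
          rw [uIcc_of_le zero_le_one] at ht
          apply ContinuousAt.continuousWithinAt
          exact continuousAt_const.div (by fun_prop) (ne_zero_of_pos_re (hre t ht))

/-- A Frullani-type integral with a cosine. -/
lemma exp_two_mul_integral_cos {c z : ℂ} (hz : 2 * |z.im| < c.re) :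
    IntegrableOn (fun y : ℝ => (1 - Complex.cos (2 * y * z)) / y * Complex.exp (-c * y)) (Ioi 0) ∧
    Complex.exp (2 * ∫ y in Ioi (0 : ℝ),
      (1 - Complex.cos (2 * y * z)) / y * Complex.exp (-c * y)) = 1 + 4 * z ^ 2 / c ^ 2 := by
  have hc : 0 < c.re := by linarith [abs_nonneg z.im]
  have hp : 0 < (c - 2 * z * Complex.I).re := by
    simp; linarith [neg_abs_le z.im]
  have hq : 0 < (c + 2 * z * Complex.I).re := by
    simp; linarith [le_abs_self z.im]
  obtain ⟨hi1, he1⟩ := frullani_exp hc hp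
  obtain ⟨hi2, he2⟩ := frullani_exp hc hq
  have key : (fun y : ℝ => (1 - Complex.cos (2 * y * z)) / y * Complex.exp (-c * y)) = fun y : ℝ =>
      (1 / 2) * ((Complex.exp (-c * y) - Complex.exp (-(c - 2 * z * Complex.I) * y)) / y +
        (Complex.exp (-c * y) - Complex.exp (-(c + 2 * z * Complex.I) * y)) / y) := by
    ext y
    rw [show -(c - 2 * z * Complex.I) * y = -c * y + 2 * y * z * Complex.I by ring,
      show -(c + 2 * z * Complex.I) * y = -c * y + -(2 * y * z) * Complex.I by ring,
      Complex.exp_add, Complex.exp_add, Complex.cos]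
    ring
  rw [key]
  refine ⟨(hi1.add hi2).const_mul _, ?_⟩
  rw [integral_const_mul, integral_add hi1 hi2, he1, he2]
  have hc0 := ne_zero_of_pos_re hc
  rw [show (2 : ℂ) * (1 / 2 * (Complex.log (c - 2 * z * Complex.I) - Complex.log c +
      (Complex.log (c + 2 * z * Complex.I) - Complex.log c))) =
      (Complex.log (c - 2 * z * Complex.I) - Complex.log c) +
      (Complex.log (c + 2 * z * Complex.I) - Complex.log c) by ring,
    Complex.exp_add, Complex.exp_sub, Complex.exp_sub, Complex.exp_log hc0,
    Complex.exp_log (ne_zero_of_pos_re hp), Complex.exp_log (ne_zero_of_pos_re hq)]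
  field_simp
  linear_combination (-4 * z ^ 2) * Complex.I_sq

/-- The product expansion of the cosine, at points where `sin (π x) ≠ 0`. -/
lemma tendsto_euler_cos_prod {x : ℂ} (hx : Complex.sin (Real.pi * x) ≠ 0) :
    Tendsto (fun N : ℕ => ∏ n ∈ Finset.range N, (1 - 4 * x ^ 2 / (2 * (n : ℂ) + 1) ^ 2)) atTop
      (𝓝 (Complex.cos (Real.pi * x))) := by
  have h1 := Complex.tendsto_euler_sin_prod x
  have h2 := (Complex.tendsto_euler_sin_prod (2 * x)).comp
    (tendsto_id.const_mul_atTop' (r := 2) (by norm_num) : Tendsto (fun N : ℕ => 2 * N) atTop atTop)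
  have hprod : ∀ N : ℕ, ∏ j ∈ Finset.range (2 * N), (1 - (2 * x) ^ 2 / ((j : ℂ) + 1) ^ 2) =
      (∏ j ∈ Finset.range N, (1 - x ^ 2 / ((j : ℂ) + 1) ^ 2)) *
      ∏ n ∈ Finset.range N, (1 - 4 * x ^ 2 / (2 * (n : ℂ) + 1) ^ 2) := by
    intro N
    induction N with
    | zero => simp
    | succ N ih =>
      rw [show 2 * (N + 1) = 2 * N + 1 + 1 by ring, Finset.prod_range_succ, Finset.prod_range_succ,
        ih, Finset.prod_range_succ, Finset.prod_range_succ]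
      have e1 : (1 - (2 * x) ^ 2 / (((2 * N : ℕ) : ℂ) + 1) ^ 2) =
          1 - 4 * x ^ 2 / (2 * (N : ℂ) + 1) ^ 2 := by push_cast; ring
      have e2 : (1 - (2 * x) ^ 2 / (((2 * N + 1 : ℕ) : ℂ) + 1) ^ 2) =
          1 - x ^ 2 / ((N : ℂ) + 1) ^ 2 := by
        have : (N : ℂ) + 1 ≠ 0 := by exact_mod_cast N.succ_ne_zero
        push_cast
        rw [show (2 * (N : ℂ) + 1 + 1) = 2 * (N + 1) by ring]
        field_simp
      rw [e1, e2]
      ring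
  have h3 := (h2.div (h1.const_mul 2) (by simpa using hx))
  have h4 : Complex.sin (Real.pi * (2 * x)) / (2 * Complex.sin (Real.pi * x)) =
      Complex.cos (Real.pi * x) := by
    rw [show (Real.pi : ℂ) * (2 * x) = 2 * (Real.pi * x) by ring, Complex.sin_two_mul]
    field_simp
  rw [h4] at h3
  refine h3.congr' ?_
  filter_upwards [h1.eventually_ne hx] with N hN
  simp only [Function.comp_apply, Pi.div_apply, hprod]
  generalize ∏ n ∈ Finset.range N, (1 - 4 * x ^ 2 / (2 * (n : ℂ) + 1) ^ 2) = Q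
  generalize ∏ j ∈ Finset.range N, (1 - x ^ 2 / ((j : ℂ) + 1) ^ 2) = P at hN ⊢
  have := left_ne_zero_of_mul hN
  have := left_ne_zero_of_mul this
  have := right_ne_zero_of_mul hN
  have : x ≠ 0 := right_ne_zero_of_mul (left_ne_zero_of_mul hN)
  field_simp

lemma hypGammaInt_sub {op om z : ℂ} (hop : 0 < op.re) {y : ℝ} (hy : 0 < y) :
    (1/(y:ℂ)) * (Complex.sin (2*(y:ℂ)*(z + Complex.I*op/2)) /
        (2 * Complex.sinh (op*(y:ℂ)) * Complex.sinh (om*(y:ℂ)))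
      - (z + Complex.I*op/2)/(op*om*(y:ℂ))) -
    (1/(y:ℂ)) * (Complex.sin (2*(y:ℂ)*(z - Complex.I*op/2)) /
        (2 * Complex.sinh (op*(y:ℂ)) * Complex.sinh (om*(y:ℂ)))
      - (z - Complex.I*op/2)/(op*om*(y:ℂ))) =
    Complex.I * ((1/(y:ℂ)) * (Complex.cos (2*(y:ℂ)*z) / Complex.sinh (om*(y:ℂ)) -
      1/(om*(y:ℂ)))) := by
  have h1 := sinh_mul_ofReal_ne_zero hop hy
  have h0 := ne_zero_of_pos_re hop
  rw [show 2*(y:ℂ)*(z + Complex.I*op/2) = 2*y*z + (op*y) * Complex.I by ring,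
    show 2*(y:ℂ)*(z - Complex.I*op/2) = 2*y*z - (op*y) * Complex.I by ring,
    Complex.sin_add, Complex.sin_sub, Complex.sin_mul_I]
  generalize Complex.sinh (op * y) = A at h1 ⊢
  field_simp
  ring

lemma abs_im_add_lt {op om z : ℂ} (hop : 0 < op.re) (hz : |z.im| < om.re / 2) :
    |(z + Complex.I * op / 2).im| < (op.re + om.re) / 2 ∧
      |(z - Complex.I * op / 2).im| < (op.re + om.re) / 2 := by
  have e : (Complex.I * op / 2).im = op.re / 2 := by simp
  rw [Complex.add_im, Complex.sub_im, e]
  rw [abs_lt] at hz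
  constructor <;> rw [abs_lt] <;> constructor <;> linarith

lemma integrableOn_cos_div_sinh {a z : ℂ} (ha : 0 < a.re) (hz : |z.im| < a.re / 2) :
    IntegrableOn (fun y : ℝ => (1/(y:ℂ)) * (Complex.cos (2*(y:ℂ)*z) / Complex.sinh (a*(y:ℂ)) -
      1/(a*(y:ℂ)))) (Ioi 0) := by
  obtain ⟨h1, h2⟩ := abs_im_add_lt ha hz
  refine (((hypGammaInt_integrableOn ha ha h1).sub (hypGammaInt_integrableOn ha ha h2)).const_mul
    (-Complex.I)).congr ?_
  filter_upwards [ae_restrict_mem measurableSet_Ioi] with y hy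
  simp only [Pi.sub_apply, hypGammaInt_sub ha hy]
  rw [← mul_assoc, neg_mul, Complex.I_mul_I, neg_neg, one_mul]

/-- The shift of the argument by `i ω₊` in the integral representation. -/
lemma hypGammaInt_shift {op om z : ℂ} (hop : 0 < op.re) (hom : 0 < om.re)
    (hz : |z.im| < om.re / 2) :
    hypGammaInt op om (z + Complex.I*op/2) =
      Complex.exp (-∫ y in Ioi (0:ℝ), (1/(y:ℂ)) * (Complex.cos (2*(y:ℂ)*z) /
        Complex.sinh (om*(y:ℂ)) - 1/(om*(y:ℂ)))) * hypGammaInt op om (z - Complex.I*op/2) := by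
  obtain ⟨h1, h2⟩ := abs_im_add_lt hop hz
  have h := integral_sub (hypGammaInt_integrableOn hop hom h1) (hypGammaInt_integrableOn hop hom h2)
  rw [setIntegral_congr_fun measurableSet_Ioi fun y hy => hypGammaInt_sub hop hy,
    integral_const_mul] at h
  rw [hypGammaInt, hypGammaInt, ← Complex.exp_add]
  congr 1
  rw [eq_sub_iff_add_eq] at h
  rw [← h, mul_add, ← mul_assoc, Complex.I_mul_I, neg_one_mul]

/-- The normalized integral `∫ (1 - cos 2yz) / (y sinh ay) dy` is the logarithm of
`cosh (π z / a)`. -/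
lemma exp_integral_one_sub_cos {a z : ℂ} (ha : 0 < a.re) (hz : |z.im| < a.re / 2) :
    IntegrableOn (fun y : ℝ => (1 - Complex.cos (2*(y:ℂ)*z)) / (y * Complex.sinh (a*(y:ℂ))))
      (Ioi 0) ∧
    Complex.exp (∫ y in Ioi (0:ℝ), (1 - Complex.cos (2*(y:ℂ)*z)) / (y * Complex.sinh (a*(y:ℂ))))
      = Complex.cosh (Real.pi * z / a) := by
  have ha0 := ne_zero_of_pos_re ha
  set g : ℕ → ℝ → ℂ := fun N y => (1 - Complex.cos (2*(y:ℂ)*z)) / (y * Complex.sinh (a*(y:ℂ))) *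
    Complex.exp (-(2 * N * a) * y) with hg
  have hg0 : g 0 = fun y : ℝ => (1 - Complex.cos (2*(y:ℂ)*z)) / (y * Complex.sinh (a*(y:ℂ))) := by
    ext y
    simp [hg]
  have hi0 : IntegrableOn (g 0) (Ioi 0) := by
    refine ((integrableOn_cos_div_sinh (z := 0) ha (by simpa using ha)).sub
      (integrableOn_cos_div_sinh ha hz)).congr ?_
    filter_upwards [ae_restrict_mem measurableSet_Ioi] with y hy
    rw [hg0]
    simp only [Pi.sub_apply, mul_zero, Complex.cos_zero, div_eq_mul_inv, mul_inv]
    ring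
  refine ⟨hg0 ▸ hi0, ?_⟩
  rw [← hg0]
  have hbound : ∀ N, ∀ᵐ y ∂(volume.restrict (Ioi (0 : ℝ))), ‖g N y‖ ≤ ‖g 0 y‖ := by
    intro N
    filter_upwards [ae_restrict_mem measurableSet_Ioi] with y hy
    have hy : 0 < y := hy
    rw [hg0]
    simp only [hg, norm_mul, Complex.norm_exp]
    refine mul_le_of_le_one_right (norm_nonneg _) (Real.exp_le_one_iff.mpr ?_)
    have : (-(2 * (N : ℂ) * a) * y).re = -(2 * N * a.re * y) := by
      rw [Complex.re_mul_ofReal, Complex.neg_re,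
        show 2 * (N : ℂ) * a = ((2 * N : ℝ) : ℂ) * a by push_cast; ring, Complex.re_ofReal_mul]
      ring
    rw [this]
    have : 0 ≤ 2 * N * a.re * y := by positivity
    linarith
  have hmeas : ∀ N, AEStronglyMeasurable (g N) (volume.restrict (Ioi (0 : ℝ))) := by
    intro N
    have h : AEStronglyMeasurable (fun y : ℝ => g 0 y * Complex.exp (-(2 * N * a) * y))
        (volume.restrict (Ioi (0 : ℝ))) :=
      hi0.aestronglyMeasurable.mul (Continuous.aestronglyMeasurable (by fun_prop))
    rw [hg0] at h
    exact h
  have hint : ∀ N, IntegrableOn (g N) (Ioi 0) := fun N => hi0.norm.mono' (hmeas N) (hbound N)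
  have hlim : Tendsto (fun N => ∫ y in Ioi (0 : ℝ), g N y) atTop (𝓝 0) := by
    have h := tendsto_integral_of_dominated_convergence (fun y => ‖g 0 y‖) hmeas hi0.norm
      hbound (f := fun _ => 0) ?_
    · simpa using h
    filter_upwards [ae_restrict_mem measurableSet_Ioi] with y hy
    have hy : 0 < y := hy
    have h1 : ‖Complex.exp (-(2 * a) * y)‖ < 1 := by
      rw [Complex.norm_exp, Real.exp_lt_one_iff, Complex.re_mul_ofReal]
      have : 0 < 2 * a.re * y := by positivity
      simp
      linarith
    have h2 := (tendsto_pow_atTop_nhds_zero_of_norm_lt_one h1).const_mul (g 0 y)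
    rw [mul_zero] at h2
    refine h2.congr fun N => ?_
    rw [← Complex.exp_nat_mul, hg0]
    simp only [hg]
    congr 2
    ring
  have hstep : ∀ N : ℕ, Complex.exp (∫ y in Ioi (0 : ℝ), g N y) =
      Complex.exp (∫ y in Ioi (0 : ℝ), g (N + 1) y) *
        (1 - 4 * (Complex.I * z / a) ^ 2 / (2 * (N : ℂ) + 1) ^ 2) := by
    intro N
    have hre : ((2 * N + 1) * a).re = (2 * N + 1) * a.re := by
      rw [show (2 * (N : ℂ) + 1) * a = ((2 * N + 1 : ℝ) : ℂ) * a by push_cast; ring,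
        Complex.re_ofReal_mul]
    obtain ⟨hk, he⟩ := exp_two_mul_integral_cos (c := (2 * N + 1) * a) (z := z) (by
      rw [hre]
      have : 0 ≤ 2 * N * a.re := by positivity
      linarith)
    have e : 1 - 4 * (Complex.I * z / a) ^ 2 / (2 * (N : ℂ) + 1) ^ 2 =
        1 + 4 * z ^ 2 / ((2 * N + 1) * a) ^ 2 := by
      rw [div_pow, mul_pow, Complex.I_sq, mul_pow, mul_comm (_ ^ 2) (a ^ 2), ← div_div]
      ring
    rw [e, ← he, ← Complex.exp_add, ← integral_const_mul, ← integral_add (hint _) (hk.const_mul 2)]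
    congr 1
    refine setIntegral_congr_fun measurableSet_Ioi fun y hy => ?_
    have hy : 0 < y := hy
    have hyc : (y : ℂ) ≠ 0 := by exact_mod_cast hy.ne'
    have hs := sinh_mul_ofReal_ne_zero ha hy
    simp only [hg]
    have e1 : Complex.exp (-(2 * ((N + 1 : ℕ) : ℂ) * a) * y) =
        Complex.exp (-(2 * N * a) * y) * (Complex.exp (-(a * y)) * Complex.exp (-(a * y))) := by
      rw [← Complex.exp_add, ← Complex.exp_add]; congr 1; push_cast; ring
    have e2 : Complex.exp (-((2 * N + 1) * a) * y) =
        Complex.exp (-(2 * N * a) * y) * Complex.exp (-(a * y)) := by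
      rw [← Complex.exp_add]; congr 1; ring
    have e3 : Complex.exp (a * y) * Complex.exp (-(a * y)) = 1 := by
      rw [← Complex.exp_add]; simp
    have e4 : 2 * Complex.sinh (a * y) = Complex.exp (a * y) - Complex.exp (-(a * y)) := by
      rw [Complex.sinh]; ring
    rw [e1, e2]
    generalize Complex.exp (-(a * y)) = u at e3 e4 ⊢
    generalize Complex.exp (a * y) = v at e3 e4 ⊢
    generalize Complex.sinh (a * y) = S at hs e4 ⊢
    field_simp
    linear_combination (-(u * e4) - e3) * (1 - Complex.cos (2 * y * z))
  have hprod : ∀ N : ℕ, Complex.exp (∫ y in Ioi (0 : ℝ), g 0 y) =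
      Complex.exp (∫ y in Ioi (0 : ℝ), g N y) *
        ∏ n ∈ Finset.range N, (1 - 4 * (Complex.I * z / a) ^ 2 / (2 * (n : ℂ) + 1) ^ 2) := by
    intro N
    induction N with
    | zero => simp
    | succ N ih => rw [ih, hstep N, Finset.prod_range_succ]; ring
  rcases eq_or_ne z 0 with rfl | hz0
  · simp [hg0]
  have hsin : Complex.sin (Real.pi * (Complex.I * z / a)) ≠ 0 := by
    intro h
    obtain ⟨k, hk⟩ := Complex.sin_eq_zero_iff.mp h
    have hpi : (Real.pi : ℂ) ≠ 0 := by exact_mod_cast Real.pi_ne_zero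
    have h1 : Complex.I * z = k * a := by
      field_simp at hk
      linear_combination hk
    have h2 : -z.im = k * a.re := by
      have := congrArg Complex.re h1
      simpa using this
    have h3 : |(k : ℝ)| * a.re < 1 * a.re := by
      rw [← abs_of_pos ha, ← abs_mul, abs_of_pos ha, ← h2, abs_neg]
      linarith
    have h4 : |(k : ℝ)| < 1 := lt_of_mul_lt_mul_right h3 ha.le
    have h5 : k = 0 := by
      rw [← Int.abs_lt_one_iff]
      exact_mod_cast h4
    rw [h5] at h1
    simp [hz0] at h1
  have h := hlim.cexp.mul (tendsto_euler_cos_prod hsin)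
  rw [tendsto_congr fun N => (hprod N).symm, Complex.exp_zero, one_mul] at h
  rw [tendsto_nhds_unique tendsto_const_nhds h,
    show (Real.pi : ℂ) * (Complex.I * z / a) = Real.pi * z / a * Complex.I by ring,
    Complex.cos_mul_I]

/-- The integral `∫ (cos 2yz / sinh ay - 1 / ay) dy / y` is minus the logarithm of
`2 cosh (π z / a)`. -/
lemma exp_neg_integral_cos_div_sinh {a z : ℂ} (ha : 0 < a.re) (hz : |z.im| < a.re / 2) :
    Complex.exp (-∫ y in Ioi (0:ℝ), (1/(y:ℂ)) * (Complex.cos (2*(y:ℂ)*z) /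
        Complex.sinh (a*(y:ℂ)) - 1/(a*(y:ℂ)))) = 2 * Complex.cosh (Real.pi * z / a) := by
  have ha0 := ne_zero_of_pos_re ha
  set f : ℂ → ℝ → ℂ := fun z y => (1/(y:ℂ)) * (Complex.cos (2*(y:ℂ)*z) /
        Complex.sinh (a*(y:ℂ)) - 1/(a*(y:ℂ))) with hf
  have hi0 : IntegrableOn (f 0) (Ioi 0) :=
    integrableOn_cos_div_sinh ha (by simpa using ha)
  have hsplit : ∀ z : ℂ, |z.im| < a.re / 2 → Complex.exp (-∫ y in Ioi (0:ℝ), f z y) =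
      Complex.exp (-∫ y in Ioi (0:ℝ), f 0 y) * Complex.cosh (Real.pi * z / a) := by
    intro z hz
    obtain ⟨hi, he⟩ := exp_integral_one_sub_cos ha hz
    rw [← he, ← Complex.exp_add, ← integral_neg, ← integral_neg,
      ← integral_add (f := fun y => -f 0 y) hi0.neg hi]
    congr 1
    refine integral_congr_ae (Eventually.of_forall fun y => ?_)
    simp only [hf, mul_zero, Complex.cos_zero, div_eq_mul_inv, mul_inv]
    ring
  have hscale : ∫ y in Ioi (0:ℝ), f (Complex.I * a / 4) y =
      (1 / 2) * ∫ y in Ioi (0:ℝ), f 0 y := by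
    have h := integral_comp_mul_left_Ioi (f 0) 0 (b := 1 / 2) (by norm_num)
    rw [mul_zero] at h
    have h' : ∫ y in Ioi (0:ℝ), f (Complex.I * a / 4) y =
        ∫ y in Ioi (0:ℝ), (1 / 4 : ℂ) * f 0 (1 / 2 * y) := by
      refine setIntegral_congr_fun measurableSet_Ioi fun y hy => ?_
      have hy : 0 < y := hy
      have hyc : (y : ℂ) ≠ 0 := by exact_mod_cast hy.ne'
      have hs := sinh_mul_ofReal_ne_zero ha (half_pos hy)
      have hc := sinh_mul_ofReal_ne_zero ha hy
      simp only [hf]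
      rw [show 2 * (y : ℂ) * (Complex.I * a / 4) = (a * (y / 2 : ℝ)) * Complex.I by push_cast; ring,
        Complex.cos_mul_I, show a * ((1 / 2 * y : ℝ) : ℂ) = a * (y / 2 : ℝ) by push_cast; ring]
      rw [show a * (y : ℂ) = 2 * (a * (y / 2 : ℝ)) by push_cast; ring, Complex.sinh_two_mul]
        at hc ⊢
      have hc' := right_ne_zero_of_mul hc
      generalize Complex.sinh (a * (y / 2 : ℝ)) = S at hs hc ⊢
      generalize Complex.cosh (a * (y / 2 : ℝ)) = C at hc hc' ⊢
      push_cast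
      rw [mul_zero, Complex.cos_zero]
      field_simp
      ring
    rw [h', integral_const_mul, h, Complex.real_smul]
    push_cast
    ring
  have hq := hsplit (Complex.I * a / 4) (by
    have : (Complex.I * a / 4).im = a.re / 4 := by simp
    rw [this, abs_of_pos (by positivity)]
    linarith)
  rw [hscale, show (Real.pi : ℂ) * (Complex.I * a / 4) / a = ((Real.pi / 4 : ℝ) : ℂ) * Complex.I by
    push_cast; field_simp, Complex.cosh_mul_I, ← Complex.ofReal_cos, Real.cos_pi_div_four] at hq
  have hhalf : Complex.exp (-∫ y in Ioi (0:ℝ), f 0 y) =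
      Complex.exp (-((1 / 2) * ∫ y in Ioi (0:ℝ), f 0 y)) ^ 2 := by
    rw [← Complex.exp_nat_mul]; congr 1; push_cast; ring
  have hne := Complex.exp_ne_zero (-((1 / 2) * ∫ y in Ioi (0:ℝ), f 0 y))
  have h2 : ((√2 : ℝ) : ℂ) ^ 2 = 2 := by
    rw [← Complex.ofReal_pow, Real.sq_sqrt (by norm_num)]; norm_num
  have hC : Complex.exp (-∫ y in Ioi (0:ℝ), f 0 y) = 2 := by
    rw [hhalf] at hq ⊢
    generalize Complex.exp (-((1 / 2) * ∫ y in Ioi (0:ℝ), f 0 y)) = c at hq hne ⊢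
    push_cast at hq
    have h3 : c * (√2 : ℝ) = 2 := by
      apply mul_left_cancel₀ hne
      linear_combination (-2) * hq
    have h4 : c ^ 2 * 2 = 2 * 2 := by
      linear_combination (c * (√2 : ℝ) + 2) * h3 - c ^ 2 * h2
    exact mul_right_cancel₀ two_ne_zero h4
  rw [hsplit z hz, hC]

lemma hypGammaInt_comm (op om z : ℂ) : hypGammaInt op om z = hypGammaInt om op z := by
  simp only [hypGammaInt, mul_assoc, mul_left_comm op om, mul_comm (Complex.sinh (op * _))]

end HypGammaAux

/-- **Functional equations** for the hyperbolic gamma function on the strip where the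
integral representation applies: `G(z+iω±/2) = 2cosh(πz/ω∓)·G(z-iω±/2)`. -/
theorem hypGamma_functional_equations (op om : ℂ) (hop : 0 < op.re) (hom : 0 < om.re) :
    (∀ z : ℂ, |z.im| < om.re/2 →
      hypGammaInt op om (z + Complex.I*op/2) =
        2 * Complex.cosh ((Real.pi:ℂ)*z/om) * hypGammaInt op om (z - Complex.I*op/2)) ∧
    (∀ z : ℂ, |z.im| < op.re/2 →
      hypGammaInt op om (z + Complex.I*om/2) =
        2 * Complex.cosh ((Real.pi:ℂ)*z/op) * hypGammaInt op om (z - Complex.I*om/2)) := by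
  refine ⟨fun z hz => ?_, fun z hz => ?_⟩
  · rw [hypGammaInt_shift hop hom hz, exp_neg_integral_cos_div_sinh hom hz]
  · rw [hypGammaInt_comm, hypGammaInt_shift hom hop hz, exp_neg_integral_cos_div_sinh hop hz,
      hypGammaInt_comm]

end
end

section
/- For ω₊, ω₋ ∈ ℂ₊, the identity G(z+iω)·G(−z+iω) = 4 sinh(πz/ω₊) sinh(πz/ω₋) holds as an identity of meromorphic functions in z ∈ ℂ, i.e. for every z at which the left-hand side is defined, where G = G(ω₊,ω₋;·) denotes the meromorphic extension of the hyperbolic gamma function and ω = (ω₊+ω₋)/2. -/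
open MeasureTheory Set
open scoped BigOperators Classical

noncomputable section

/-- The locus `-iω - Λ` (with `ω = (ω₊+ω₋)/2`, `Λ = ℤ≥0·iω₊ + ℤ≥0·iω₋`) containing the
poles of the hyperbolic gamma function; off this set the meromorphic extension is defined. -/
def hypGammaPoles (op om : ℂ) : Set ℂ :=
  {z | ∃ m n : ℕ, z = -Complex.I*(op+om)/2 - (m:ℂ)*Complex.I*op - (n:ℂ)*Complex.I*om}

/-- Predicate expressing that `G : ℂ → ℂ` is the meromorphic extension in `z` of
Ruijsenaars' hyperbolic gamma function with quasi-periods `ω₊ = op`, `ω₋ = om`: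
it agrees with the integral representation on the strip `|Im z| < Re((ω₊+ω₋)/2)`,
satisfies both functional equations (away from the zeros of the `cosh` factor, where
the two sides have poles), and is continuous away from the pole locus. -/
structure IsHypGamma (op om : ℂ) (G : ℂ → ℂ) : Prop where
  strip : ∀ z : ℂ, |z.im| < ((op+om)/2).re → G z = hypGammaInt op om z
  funEqm : ∀ z : ℂ, Complex.cosh (Real.pi * z / op) ≠ 0 →
    G (z + Complex.I * om/2) = 2 * Complex.cosh (Real.pi * z / op) * G (z - Complex.I * om/2)
  funEqp : ∀ z : ℂ, Complex.cosh (Real.pi * z / om) ≠ 0 →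
    G (z + Complex.I * op/2) = 2 * Complex.cosh (Real.pi * z / om) * G (z - Complex.I * op/2)
  cont : ContinuousOn G (hypGammaPoles op om)ᶜ


theorem countable_cosh_affine_zeros {a : ℂ} (ha : a ≠ 0) (b : ℂ) :
    {z : ℂ | Complex.cosh (a * z + b) = 0}.Countable := by
  have hz : {x : ℂ | Complex.cos x = 0}.Countable := by
    refine (Set.countable_range fun k : ℤ => (2 * (k : ℂ) + 1) * Real.pi / 2).mono ?_
    intro x hx
    obtain ⟨k, hk⟩ := Complex.cos_eq_zero_iff.1 hx
    exact ⟨k, hk.symm⟩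
  have hinj : Function.Injective fun z : ℂ => (a * z + b) * Complex.I := by
    intro x y h
    simpa [Complex.I_ne_zero, ha] using h
  refine (hz.preimage hinj).mono ?_
  intro z hz
  simpa [Complex.cos_mul_I] using hz

theorem countable_hypGammaPoles (op om : ℂ) : (hypGammaPoles op om).Countable := by
  refine (Set.countable_range fun p : ℕ × ℕ =>
    -Complex.I*(op+om)/2 - (p.1:ℂ)*Complex.I*op - (p.2:ℂ)*Complex.I*om).mono ?_
  rintro z ⟨m, n, rfl⟩
  exact ⟨(m, n), rfl⟩

theorem hypGammaInt_mul_neg (op om z : ℂ) :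
    hypGammaInt op om z * hypGammaInt op om (-z) = 1 := by
  unfold hypGammaInt
  rw [← Complex.exp_add, ← mul_add, ← Complex.exp_zero]
  congr 1
  rw [mul_eq_zero]
  right
  rw [add_comm, ← eq_neg_iff_add_eq_zero, ← MeasureTheory.integral_neg]
  congr 1
  ext y
  simp only [mul_neg, Complex.sin_neg]
  ring

namespace IsHypGamma

variable {op om : ℂ} {G : ℂ → ℂ}

theorem mul_neg_shift (hG : IsHypGamma op om G) {v : ℂ}
    (hv : Complex.cosh (Real.pi * v / op) ≠ 0) :
    G (v + Complex.I * om / 2) * G (-(v + Complex.I * om / 2)) =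
      G (v - Complex.I * om / 2) * G (-(v - Complex.I * om / 2)) := by
  have e : Complex.cosh (Real.pi * -v / op) = Complex.cosh (Real.pi * v / op) := by
    rw [← Complex.cosh_neg]
    congr 1
    ring
  have h2 := hG.funEqm (-v) (by rwa [e])
  rw [e] at h2
  rw [hG.funEqm v hv, show -(v - Complex.I * om / 2) = -v + Complex.I * om / 2 by ring, h2,
    show -(v + Complex.I * om / 2) = -v - Complex.I * om / 2 by ring]
  ring

theorem mul_neg_eq_one (hG : IsHypGamma op om G) (hop : 0 < op.re) (hom : 0 < om.re) {w : ℂ}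
    (hw : ∀ k : ℤ, Complex.cosh (Real.pi * (w + (k + 1 / 2) * (Complex.I * om)) / op) ≠ 0) :
    G w * G (-w) = 1 := by
  have step : ∀ k : ℤ, G (w + (k + 1) * (Complex.I * om)) * G (-(w + (k + 1) * (Complex.I * om))) =
      G (w + k * (Complex.I * om)) * G (-(w + k * (Complex.I * om))) := by
    intro k
    have h := hG.mul_neg_shift (hw k)
    convert h using 3 <;> ring
  have shift : ∀ k : ℤ, G (w + k * (Complex.I * om)) * G (-(w + k * (Complex.I * om))) =
      G w * G (-w) := by
    intro k
    induction k using Int.induction_on with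
    | zero => simp
    | succ n ih => rw [← ih, ← step n]; push_cast; rfl
    | pred n ih => rw [← ih, ← step (-(n : ℤ) - 1)]; push_cast; simp
  rw [← shift (-round (w.im / om.re))]
  set u := w + ((-round (w.im / om.re) : ℤ) : ℂ) * (Complex.I * om) with hu
  have him : u.im = (w.im / om.re - round (w.im / om.re)) * om.re := by
    rw [hu, sub_mul, div_mul_cancel₀ _ hom.ne']
    simp [Complex.add_im, Complex.mul_im]
    ring
  have hstrip : |u.im| < ((op + om) / 2).re := by
    have h := abs_sub_round (w.im / om.re)
    have hre : ((op + om) / 2).re = (op.re + om.re) / 2 := by simp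
    rw [him, abs_mul, abs_of_pos hom, hre]
    nlinarith
  rw [hG.strip u hstrip, hG.strip (-u) (by simpa using hstrip), hypGammaInt_mul_neg]

theorem sinh_product_of_generic (hG : IsHypGamma op om G) (hop : 0 < op.re) (hom : 0 < om.re)
    {z : ℂ}
    (hp : Complex.cosh (Real.pi * (z + Complex.I * op / 2) / op) ≠ 0)
    (hm : Complex.cosh (Real.pi * (-z + Complex.I * om / 2) / om) ≠ 0)
    (hw : ∀ k : ℤ, Complex.cosh (Real.pi * (z + Complex.I * (op - om) / 2 +
      (k + 1 / 2) * (Complex.I * om)) / op) ≠ 0) :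
    G (z + Complex.I*(op+om)/2) * G (-z + Complex.I*(op+om)/2) =
      4 * Complex.sinh ((Real.pi:ℂ)*z/op) * Complex.sinh ((Real.pi:ℂ)*z/om) := by
  have hop0 : op ≠ 0 := by rintro rfl; simp at hop
  have hom0 : om ≠ 0 := by rintro rfl; simp at hom
  have cosh_add : ∀ x : ℂ, Complex.cosh (x + Real.pi / 2 * Complex.I) =
      Complex.sinh x * Complex.I := by
    intro x
    rw [Complex.cosh_add, Complex.cosh_mul_I, Complex.sinh_mul_I, Complex.cos_pi_div_two,
      Complex.sin_pi_div_two]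
    ring
  have ep : Complex.cosh (Real.pi * (z + Complex.I * op / 2) / op) =
      Complex.sinh (Real.pi * z / op) * Complex.I := by
    rw [← cosh_add]
    congr 1
    field_simp
  have em : Complex.cosh (Real.pi * (-z + Complex.I * om / 2) / om) =
      -Complex.sinh (Real.pi * z / om) * Complex.I := by
    rw [← Complex.sinh_neg, ← cosh_add]
    congr 1
    field_simp
  have gp := hG.funEqm _ hp
  have gm := hG.funEqp _ hm
  have hone := hG.mul_neg_eq_one hop hom hw
  rw [ep, show z + Complex.I * op / 2 + Complex.I * om / 2 = z + Complex.I * (op + om) / 2 by ring,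
    show z + Complex.I * op / 2 - Complex.I * om / 2 = z + Complex.I * (op - om) / 2 by ring] at gp
  rw [em,
    show -z + Complex.I * om / 2 + Complex.I * op / 2 = -z + Complex.I * (op + om) / 2 by ring,
    show -z + Complex.I * om / 2 - Complex.I * op / 2 = -(z + Complex.I * (op - om) / 2) by ring]
    at gm
  rw [gp, gm]
  linear_combination (-4 * Complex.I ^ 2 * Complex.sinh (Real.pi * z / op) *
    Complex.sinh (Real.pi * z / om)) * hone - 4 * Complex.sinh (Real.pi * z / op) *
    Complex.sinh (Real.pi * z / om) * Complex.I_sq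

end IsHypGamma

/-- For `ω₊, ω₋ ∈ ℂ₊` the identity `G(z+iω)G(-z+iω) = 4 sinh(πz/ω₊) sinh(πz/ω₋)` holds
for every `z` at which the left-hand side is defined (i.e. neither argument lies on the
pole locus), where `G` is the meromorphic extension of the hyperbolic gamma function and
`ω = (ω₊+ω₋)/2`. -/
theorem hypGamma_sinh_product (op om : ℂ) (hop : 0 < op.re) (hom : 0 < om.re)
    (G : ℂ → ℂ) (hG : IsHypGamma op om G) (z : ℂ)
    (h1 : z + Complex.I*(op+om)/2 ∉ hypGammaPoles op om)
    (h2 : -z + Complex.I*(op+om)/2 ∉ hypGammaPoles op om) :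
    G (z + Complex.I*(op+om)/2) * G (-z + Complex.I*(op+om)/2) =
      4 * Complex.sinh ((Real.pi:ℂ)*z/op) * Complex.sinh ((Real.pi:ℂ)*z/om) := by
  have hop0 : op ≠ 0 := by rintro rfl; simp at hop
  have hom0 : om ≠ 0 := by rintro rfl; simp at hom
  have hpi : (Real.pi : ℂ) ≠ 0 := Complex.ofReal_ne_zero.2 Real.pi_ne_zero
  let S : Set ℂ := {z | z + Complex.I*(op+om)/2 ∉ hypGammaPoles op om ∧
    -z + Complex.I*(op+om)/2 ∉ hypGammaPoles op om}
  let B : Set ℂ := (fun z => z + Complex.I*(op+om)/2) ⁻¹' hypGammaPoles op om ∪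
    (fun z => -z + Complex.I*(op+om)/2) ⁻¹' hypGammaPoles op om ∪
    {z | Complex.cosh (Real.pi * (z + Complex.I * op / 2) / op) = 0} ∪
    {z | Complex.cosh (Real.pi * (-z + Complex.I * om / 2) / om) = 0} ∪
    ⋃ k : ℤ, {z | Complex.cosh (Real.pi * (z + Complex.I * (op - om) / 2 +
      (k + 1 / 2) * (Complex.I * om)) / op) = 0}
  have hB : B.Countable := by
    refine ((((?_ : Set.Countable _).union ?_).union ?_).union ?_).union
      (Set.countable_iUnion fun k => ?_)
    · exact (countable_hypGammaPoles op om).preimage (add_left_injective _)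
    · exact (countable_hypGammaPoles op om).preimage
        ((add_left_injective _).comp neg_injective)
    · refine (countable_cosh_affine_zeros (div_ne_zero hpi hop0)
        (Real.pi * (Complex.I * op / 2) / op)).mono fun z hz => ?_
      rw [Set.mem_ofPred_eq] at hz ⊢
      rw [← hz]
      congr 1
      ring
    · refine (countable_cosh_affine_zeros (div_ne_zero (neg_ne_zero.2 hpi) hom0)
        (Real.pi * (Complex.I * om / 2) / om)).mono fun z hz => ?_
      rw [Set.mem_ofPred_eq] at hz ⊢
      rw [← hz]
      congr 1
      ring
    · refine (countable_cosh_affine_zeros (div_ne_zero hpi hop0)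
        (Real.pi * (Complex.I * (op - om) / 2 + (k + 1 / 2) * (Complex.I * om)) / op)).mono
        fun z hz => ?_
      rw [Set.mem_ofPred_eq] at hz ⊢
      rw [← hz]
      congr 1
      ring
  have hBS : Bᶜ ⊆ S := fun z hz =>
    ⟨fun h => hz (Or.inl (Or.inl (Or.inl (Or.inl h)))),
      fun h => hz (Or.inl (Or.inl (Or.inl (Or.inr h))))⟩
  have heq : Set.EqOn
      (fun z => G (z + Complex.I*(op+om)/2) * G (-z + Complex.I*(op+om)/2))
      (fun z => 4 * Complex.sinh ((Real.pi:ℂ)*z/op) * Complex.sinh ((Real.pi:ℂ)*z/om)) Bᶜ :=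
    fun z hz => hG.sinh_product_of_generic hop hom
      (fun h => hz (Or.inl (Or.inl (Or.inr h)))) (fun h => hz (Or.inl (Or.inr h)))
      (fun k h => hz (Or.inr (Set.mem_iUnion.2 ⟨k, h⟩)))
  refine heq.of_subset_closure (t := S) ?_ ?_ hBS ?_ ⟨h1, h2⟩
  · exact (hG.cont.comp (by fun_prop) fun z hz => hz.1).mul
      (hG.cont.comp (by fun_prop) fun z hz => hz.2)
  · exact Continuous.continuousOn (by fun_prop)
  · rw [(hB.dense_compl ℂ).closure_eq]
    exact Set.subset_univ S

end
end

section
/- Special values of the hyperbolic gamma function: for ω₊, ω₋ ∈ ℂ₊ one has G(ω₊,ω₋; i(ω₋−ω₊)/2) = √(ω₋/ω₊), and G(ω₊,ω₋; iω₊/2) = G(ω₊,ω₋; iω₋/2) = √2; equivalently, exp( (1/2)∫₀^∞ ( 1/(ω∓y²) − 1/(y sinh(ω∓y)) ) dy ) = √2. -/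
open MeasureTheory Set
open scoped BigOperators Classical

noncomputable section

lemma re_le_norm_sinh {w : ℂ} (hw : 0 ≤ w.re) : w.re ≤ ‖Complex.sinh w‖ := by
  have h1 : w.re ≤ Real.sinh w.re := Real.self_le_sinh_iff.2 hw
  have h2 : ‖Complex.exp w‖ - ‖Complex.exp (-w)‖ ≤ ‖Complex.exp w - Complex.exp (-w)‖ :=
    norm_sub_norm_le _ _
  rw [← Complex.two_sinh, norm_mul, Complex.norm_exp, Complex.norm_exp, Complex.neg_re] at h2
  rw [Real.sinh_eq] at h1
  norm_num at h2
  linarith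

lemma sinh_ne_zero_of_re_pos {w : ℂ} (hw : 0 < w.re) : Complex.sinh w ≠ 0 :=
  norm_pos_iff.1 (hw.trans_le (re_le_norm_sinh hw.le))

lemma ne_zero_of_re_pos {w : ℂ} (hw : 0 < w.re) : w ≠ 0 := by
  rintro rfl
  simp at hw

lemma norm_cosh_sub_one_le {w : ℂ} (hw : ‖w‖ ≤ 1) : ‖Complex.cosh w - 1‖ ≤ ‖w‖ ^ 2 := by
  have h1 := Complex.norm_exp_sub_one_sub_id_le hw
  have h2 := Complex.norm_exp_sub_one_sub_id_le (x := -w) (by rwa [norm_neg])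
  rw [norm_neg] at h2
  have h3 : Complex.cosh w - 1 =
      ((Complex.exp w - 1 - w) + (Complex.exp (-w) - 1 - -w)) / 2 := by
    rw [Complex.cosh]; ring
  have h4 := norm_add_le (Complex.exp w - 1 - w) (Complex.exp (-w) - 1 - -w)
  rw [h3, norm_div, Complex.norm_two]
  linarith

lemma norm_sinh_sub_self_le {w : ℂ} (hw : ‖w‖ ≤ 1) : ‖Complex.sinh w - w‖ ≤ ‖w‖ ^ 3 := by
  have h1 := Complex.exp_bound hw (n := 3) (by norm_num)
  have h2 := Complex.exp_bound (x := -w) (by rwa [norm_neg]) (n := 3) (by norm_num)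
  rw [norm_neg] at h2
  set u := Complex.exp w - ∑ m ∈ Finset.range 3, w ^ m / m.factorial with hu
  set v := Complex.exp (-w) - ∑ m ∈ Finset.range 3, (-w) ^ m / m.factorial with hv
  have h3 : Complex.sinh w - w = (u - v) / 2 := by
    rw [Complex.sinh, hu, hv]
    simp [Finset.sum_range_succ, Nat.factorial]
    ring
  have h4 := norm_sub_le u v
  rw [h3, norm_div, Complex.norm_two]
  norm_num [Nat.factorial] at h1 h2
  have : 0 ≤ ‖w‖ ^ 3 := by positivity
  linarith

/-- The Langevin function `coth w - 1 / w`. -/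
def langevin (w : ℂ) : ℂ := Complex.cosh w / Complex.sinh w - 1 / w

/-- The derivative of the Langevin function. -/
def langevinDeriv (w : ℂ) : ℂ := 1 / w ^ 2 - 1 / Complex.sinh w ^ 2

lemma hasDerivAt_langevin {w : ℂ} (hw : 0 < w.re) :
    HasDerivAt langevin (langevinDeriv w) w := by
  have hs := sinh_ne_zero_of_re_pos hw
  have h0 := ne_zero_of_re_pos hw
  have h := ((Complex.hasDerivAt_cosh w).div (Complex.hasDerivAt_sinh w) hs).sub
    ((hasDerivAt_const w (1 : ℂ)).div (hasDerivAt_id w) h0)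
  refine h.congr_deriv ?_
  have := Complex.cosh_sq w
  simp only [langevinDeriv, id]
  field_simp
  rw [this]
  ring

lemma langevin_sub_langevin_half {w : ℂ} (hw : 0 < w.re) :
    langevin w - langevin (w / 2) = 1 / w - 1 / Complex.sinh w := by
  obtain ⟨v, rfl⟩ : ∃ v, w = 2 * v := ⟨w / 2, by ring⟩
  have hv : 0 < v.re := by simpa using hw
  have hs := sinh_ne_zero_of_re_pos hv
  have hs2 := sinh_ne_zero_of_re_pos hw
  have h0 := ne_zero_of_re_pos hv
  have e : 2 * v / 2 = v := by ring
  have key : Complex.cosh (2 * v) / Complex.sinh (2 * v) + 1 / Complex.sinh (2 * v) =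
      Complex.cosh v / Complex.sinh v := by
    have hc : Complex.cosh v ≠ 0 := by
      intro hc
      rw [Complex.sinh_two_mul, hc] at hs2
      simp at hs2
    rw [Complex.cosh_two_mul, Complex.sinh_two_mul, Complex.sinh_sq]
    field_simp
    ring
  rw [e, langevin, langevin, ← key]
  field_simp
  ring

lemma norm_langevin_le {w : ℂ} (hw : 0 < w.re) (hw1 : ‖w‖ ≤ 1) :
    ‖langevin w‖ ≤ 2 * ‖w‖ ^ 2 / w.re := by
  have hs := sinh_ne_zero_of_re_pos hw
  have h0 := ne_zero_of_re_pos hw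
  have hpos : 0 < ‖w‖ := norm_pos_iff.2 h0
  have e : langevin w =
      (w * (Complex.cosh w - 1) - (Complex.sinh w - w)) / (w * Complex.sinh w) := by
    rw [langevin]
    field_simp
    ring
  have h1 := norm_sub_le (w * (Complex.cosh w - 1)) (Complex.sinh w - w)
  have h2 := norm_sinh_sub_self_le hw1
  have h3 := mul_le_mul_of_nonneg_left (norm_cosh_sub_one_le hw1) hpos.le
  rw [norm_mul] at h1
  rw [e, norm_div, norm_mul]
  calc _ ≤ 2 * ‖w‖ ^ 3 / (‖w‖ * w.re) := by
        gcongr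
        · nlinarith
        · exact re_le_norm_sinh hw.le
    _ = _ := by field_simp

lemma norm_langevin_sub_one_le {w : ℂ} (hw : 0 < w.re) : ‖langevin w - 1‖ ≤ 2 / w.re := by
  have hs := sinh_ne_zero_of_re_pos hw
  have h0 := ne_zero_of_re_pos hw
  have e : langevin w - 1 = Complex.exp (-w) / Complex.sinh w - 1 / w := by
    rw [langevin, ← Complex.cosh_sub_sinh]
    field_simp
    ring
  have h1 := norm_sub_le (Complex.exp (-w) / Complex.sinh w) (1 / w)
  have h2 : ‖Complex.exp (-w) / Complex.sinh w‖ ≤ 1 / w.re := by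
    rw [norm_div]
    gcongr
    · rw [Complex.norm_exp]
      exact Real.exp_le_one_iff.2 (by simpa using hw.le)
    · exact re_le_norm_sinh hw.le
  have h3 : ‖1 / w‖ ≤ 1 / w.re := by
    rw [norm_div, norm_one]
    gcongr
    exact Complex.re_le_norm w
  rw [e]
  calc _ ≤ 1 / w.re + 1 / w.re := by linarith
    _ = _ := by ring

lemma norm_langevinDeriv_le_of_norm_le_one {w : ℂ} (hw : 0 < w.re) (hw1 : ‖w‖ ≤ 1) :
    ‖langevinDeriv w‖ ≤ 3 * ‖w‖ ^ 2 / w.re ^ 2 := by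
  have hs := sinh_ne_zero_of_re_pos hw
  have h0 := ne_zero_of_re_pos hw
  have hpos : 0 < ‖w‖ := norm_pos_iff.2 h0
  have e : langevinDeriv w = ((Complex.sinh w - w) * ((Complex.sinh w - w) + 2 * w)) /
      (w ^ 2 * Complex.sinh w ^ 2) := by
    rw [langevinDeriv]
    field_simp
    ring
  have h2 := norm_sinh_sub_self_le hw1
  have h3 : ‖(Complex.sinh w - w) + 2 * w‖ ≤ 3 * ‖w‖ := by
    have h4 := norm_add_le (Complex.sinh w - w) (2 * w)
    rw [norm_mul, Complex.norm_two] at h4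
    have h5 : ‖w‖ ^ 3 ≤ ‖w‖ := pow_le_of_le_one hpos.le hw1 (by norm_num)
    linarith
  rw [e, norm_div, norm_mul, norm_mul, norm_pow, norm_pow]
  calc _ ≤ ‖w‖ ^ 3 * (3 * ‖w‖) / (‖w‖ ^ 2 * w.re ^ 2) := by
        gcongr
        exact re_le_norm_sinh hw.le
    _ = _ := by field_simp

lemma norm_langevinDeriv_le {w : ℂ} (hw : 0 < w.re) : ‖langevinDeriv w‖ ≤ 2 / w.re ^ 2 := by
  have h1 := norm_sub_le (1 / w ^ 2) (1 / Complex.sinh w ^ 2)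
  have h2 : ‖1 / Complex.sinh w ^ 2‖ ≤ 1 / w.re ^ 2 := by
    rw [norm_div, norm_one, norm_pow]
    gcongr
    exact re_le_norm_sinh hw.le
  have h3 : ‖1 / w ^ 2‖ ≤ 1 / w.re ^ 2 := by
    rw [norm_div, norm_one, norm_pow]
    gcongr
    exact Complex.re_le_norm w
  rw [langevinDeriv]
  calc _ ≤ 1 / w.re ^ 2 + 1 / w.re ^ 2 := by linarith
    _ = _ := by ring

lemma norm_langevinDeriv_mul_le {c R y : ℝ} {a : ℂ} (hc : 0 < c) (hca : c ≤ a.re)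
    (haR : ‖a‖ ≤ R) (hy : 0 < y) :
    ‖langevinDeriv (a * y)‖ ≤ 3 * (R ^ 2 + 1) / c ^ 2 * (1 + y ^ 2)⁻¹ := by
  have hre : (a * y).re = a.re * y := by simp
  have hnorm : ‖a * y‖ = ‖a‖ * y := by rw [norm_mul, Complex.norm_real, Real.norm_of_nonneg hy.le]
  have hpos : 0 < (a * y).re := by rw [hre]; nlinarith
  have hR : 0 < R := by linarith [Complex.re_le_norm a]
  rw [← div_eq_mul_inv, le_div_iff₀ (by positivity)]
  rcases le_or_gt (R * y) 1 with h | h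
  · have h1 := norm_langevinDeriv_le_of_norm_le_one hpos
      (by rw [hnorm]; exact (mul_le_mul_of_nonneg_right haR hy.le).trans h)
    rw [hnorm, hre] at h1
    have h2 : 3 * (‖a‖ * y) ^ 2 / (a.re * y) ^ 2 ≤ 3 * R ^ 2 / c ^ 2 := by
      calc _ ≤ 3 * (R * y) ^ 2 / (c * y) ^ 2 := by gcongr
        _ = _ := by field_simp
    calc _ ≤ 3 * R ^ 2 / c ^ 2 * (1 + y ^ 2) := by gcongr; exact h1.trans h2
      _ = 3 * (R ^ 2 + (R * y) ^ 2) / c ^ 2 := by ring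
      _ ≤ _ := by
        gcongr
        exact pow_le_one₀ (by positivity) h
  · have h1 := norm_langevinDeriv_le hpos
    rw [hre] at h1
    have h2 : 2 / (a.re * y) ^ 2 ≤ 3 / (c * y) ^ 2 := by
      gcongr
      norm_num
    calc _ ≤ 3 / (c * y) ^ 2 * (1 + y ^ 2) := by gcongr; exact h1.trans h2
      _ = 3 * (1 + 1 / y ^ 2) / c ^ 2 := by field_simp; ring
      _ ≤ _ := by
        rw [add_comm (1 : ℝ)]
        gcongr
        rw [div_le_iff₀ (by positivity), ← mul_pow]
        exact one_le_pow₀ h.le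

lemma continuousAt_langevinDeriv {w : ℂ} (hw : 0 < w.re) : ContinuousAt langevinDeriv w := by
  have hs := sinh_ne_zero_of_re_pos hw
  have h0 := ne_zero_of_re_pos hw
  exact (continuousAt_const.div (continuousAt_id.pow 2) (pow_ne_zero 2 h0)).sub
    (continuousAt_const.div (Complex.continuous_sinh.continuousAt.pow 2) (pow_ne_zero 2 hs))

lemma re_mul_ofReal_pos {a : ℂ} (ha : 0 < a.re) {y : ℝ} (hy : 0 < y) : 0 < (a * y).re := by
  simpa using mul_pos ha hy

lemma integrableOn_langevinDeriv_mul {a : ℂ} (ha : 0 < a.re) :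
    IntegrableOn (fun y : ℝ => langevinDeriv (a * y)) (Ioi 0) := by
  refine ((integrable_inv_one_add_sq.const_mul
    (3 * (‖a‖ ^ 2 + 1) / a.re ^ 2)).integrableOn (s := Ioi 0)).mono' ?_ ?_
  · refine ContinuousOn.aestronglyMeasurable (fun y hy => ?_) measurableSet_Ioi
    exact ((continuousAt_langevinDeriv (re_mul_ofReal_pos ha hy)).comp
      (f := fun y : ℝ => a * y) (by fun_prop)).continuousWithinAt
  · filter_upwards [ae_restrict_mem measurableSet_Ioi] with y hy
    exact norm_langevinDeriv_mul_le ha le_rfl le_rfl hy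

lemma integral_langevinDeriv_mul {a : ℂ} (ha : 0 < a.re) :
    ∫ y in Ioi (0 : ℝ), langevinDeriv (a * y) = 1 / a := by
  have h0 := ne_zero_of_re_pos ha
  have key := integral_Ioi_of_hasDerivAt_of_tendsto (a := 0) (m := 1 / a)
    (f := fun y : ℝ => langevin (a * y) / a) (f' := fun y : ℝ => langevinDeriv (a * y))
    ?_ ?_ (integrableOn_langevinDeriv_mul ha) ?_
  · rw [key]
    simp [langevin]
  · have h : Filter.Tendsto (fun y : ℝ => langevin (a * y)) (nhdsWithin 0 (Ici 0)) (nhds 0) := by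
      have hg : Filter.Tendsto (fun y : ℝ => 2 * ‖a‖ ^ 2 / a.re * y) (nhdsWithin 0 (Ici 0))
          (nhds 0) := by
        refine (Continuous.tendsto' (by fun_prop) _ _ (by simp)).mono_left nhdsWithin_le_nhds
      refine squeeze_zero_norm' ?_ hg
      have hs : ∀ᶠ y : ℝ in nhdsWithin 0 (Ici 0), ‖a * (y : ℂ)‖ < 1 := by
        refine nhdsWithin_le_nhds ?_
        have hcont : Continuous fun y : ℝ => ‖a * (y : ℂ)‖ := by fun_prop
        exact hcont.continuousAt.eventually_lt continuousAt_const (by simp)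
      filter_upwards [hs, self_mem_nhdsWithin] with y hy1 hy
      rcases (mem_Ici.1 hy).eq_or_lt with rfl | hy
      · simp [langevin]
      · refine (norm_langevin_le (re_mul_ofReal_pos ha hy) hy1.le).trans_eq ?_
        rw [norm_mul, Complex.norm_real, Real.norm_of_nonneg hy.le, Complex.re_mul_ofReal]
        field_simp
    have h' := h.div_const a
    rw [zero_div] at h'
    simpa [ContinuousWithinAt, langevin] using h'
  · intro y hy
    have h1 : HasDerivAt (fun z : ℂ => langevin (a * z) / a) (langevinDeriv (a * y)) (y : ℂ) := by
      have h2 := ((hasDerivAt_langevin (re_mul_ofReal_pos ha hy)).comp (y : ℂ)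
        ((hasDerivAt_id (y : ℂ)).const_mul a)).div_const a
      refine h2.congr_deriv ?_
      field_simp
    exact h1.comp_ofReal
  · refine Filter.Tendsto.div_const ?_ a
    rw [tendsto_iff_norm_sub_tendsto_zero]
    have hg : Filter.Tendsto (fun y : ℝ => 2 / a.re / y) Filter.atTop (nhds 0) :=
      Filter.Tendsto.const_div_atTop Filter.tendsto_id _
    refine squeeze_zero' (Filter.Eventually.of_forall fun _ => norm_nonneg _) ?_ hg
    filter_upwards [Filter.eventually_gt_atTop 0] with y hy
    refine (norm_langevin_sub_one_le (re_mul_ofReal_pos ha hy)).trans_eq ?_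
    rw [Complex.re_mul_ofReal, div_div]

/-- Frullani's integral for the Langevin function, with complex dilation parameters. -/
lemma integral_langevin_sub_div {a b : ℂ} (ha : 0 < a.re) (hb : 0 < b.re) :
    ∫ y in Ioi (0 : ℝ), (langevin (a * y) - langevin (b * y)) / y =
      Complex.log a - Complex.log b := by
  set γ : ℝ → ℂ := fun t => b + t * (a - b) with hγ
  set c := min a.re b.re
  have hc : 0 < c := lt_min ha hb
  have hγc : ∀ t ∈ Icc (0 : ℝ) 1, c ≤ (γ t).re := by
    rintro t ⟨h0, h1⟩
    have e : (γ t).re = (1 - t) * b.re + t * a.re := by simp [hγ]; ring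
    rw [e]
    nlinarith [min_le_left a.re b.re, min_le_right a.re b.re]
  have hγR : ∀ t ∈ Icc (0 : ℝ) 1, ‖γ t‖ ≤ ‖b‖ + ‖a - b‖ := by
    rintro t ⟨h0, h1⟩
    refine (norm_add_le _ _).trans ?_
    rw [norm_mul, Complex.norm_real, Real.norm_of_nonneg h0]
    gcongr
    exact mul_le_of_le_one_left (norm_nonneg _) h1
  have hγpos : ∀ t ∈ Icc (0 : ℝ) 1, 0 < (γ t).re := fun t ht => hc.trans_le (hγc t ht)
  have hγd : ∀ t, HasDerivAt γ (a - b) t := fun t => by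
    have h := (((hasDerivAt_id (t : ℂ)).mul_const (a - b)).const_add b).comp_ofReal
    rwa [one_mul] at h
  have hcont : Continuous γ := by fun_prop
  have hint : Integrable (Function.uncurry fun (t y : ℝ) => langevinDeriv (γ t * y) * (a - b))
      ((volume.restrict (Ioc 0 1)).prod (volume.restrict (Ioi 0))) := by
    refine Integrable.mul_const ?_ _
    have hdom := ((integrable_inv_one_add_sq.const_mul
      (3 * ((‖b‖ + ‖a - b‖) ^ 2 + 1) / c ^ 2)).integrableOn (s := Ioi 0)).comp_snd
        (volume.restrict (Ioc (0 : ℝ) 1))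
    have hmem : ∀ᵐ p ∂((volume.restrict (Ioc (0 : ℝ) 1)).prod (volume.restrict (Ioi (0 : ℝ)))),
        p ∈ Ioc (0 : ℝ) 1 ×ˢ Ioi (0 : ℝ) := by
      rw [Measure.prod_restrict]
      exact ae_restrict_mem (measurableSet_Ioc.prod measurableSet_Ioi)
    refine hdom.mono' ?_ ?_
    · rw [Measure.prod_restrict]
      refine ContinuousOn.aestronglyMeasurable (fun p hp => ?_)
        (measurableSet_Ioc.prod measurableSet_Ioi)
      exact ((continuousAt_langevinDeriv (re_mul_ofReal_pos
        (hγpos _ (Ioc_subset_Icc_self hp.1)) hp.2)).comp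
          (f := fun p : ℝ × ℝ => γ p.1 * p.2) (by fun_prop)).continuousWithinAt
    · filter_upwards [hmem] with p hp
      have ht := Ioc_subset_Icc_self hp.1
      exact norm_langevinDeriv_mul_le hc (hγc _ ht) (hγR _ ht) hp.2
  have hinner : ∀ y ∈ Ioi (0 : ℝ), (langevin (a * y) - langevin (b * y)) / y =
      ∫ t in Ioc (0 : ℝ) 1, langevinDeriv (γ t * y) * (a - b) := by
    intro y hy
    have hy0 : (y : ℂ) ≠ 0 := by exact_mod_cast (ne_of_gt hy)
    rw [← intervalIntegral.integral_of_le zero_le_one,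
      intervalIntegral.integral_eq_sub_of_hasDerivAt (f := fun t => langevin (γ t * y) / y)]
    · simp [hγ, sub_div]
    · intro t ht
      rw [uIcc_of_le zero_le_one] at ht
      have h := ((hasDerivAt_langevin (re_mul_ofReal_pos (hγpos t ht) hy)).comp t
        ((hγd t).mul_const (y : ℂ))).div_const (y : ℂ)
      refine h.congr_deriv ?_
      field_simp
    · refine ContinuousOn.intervalIntegrable fun t ht => ?_
      rw [uIcc_of_le zero_le_one] at ht
      exact (((continuousAt_langevinDeriv (re_mul_ofReal_pos (hγpos t ht) hy)).comp
        (f := fun t : ℝ => γ t * y) (by fun_prop)).mul continuousAt_const).continuousWithinAt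
  rw [setIntegral_congr_fun measurableSet_Ioi hinner, ← integral_integral_swap hint]
  have houter : ∀ t ∈ Ioc (0 : ℝ) 1,
      ∫ y in Ioi (0 : ℝ), langevinDeriv (γ t * y) * (a - b) = (a - b) / γ t := by
    intro t ht
    rw [integral_mul_const, integral_langevinDeriv_mul (hγpos t (Ioc_subset_Icc_self ht))]
    ring
  rw [setIntegral_congr_fun measurableSet_Ioc houter,
    ← intervalIntegral.integral_of_le zero_le_one,
    intervalIntegral.integral_eq_sub_of_hasDerivAt (f := fun t => Complex.log (γ t))]
  · simp [hγ]
  · intro t ht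
    rw [uIcc_of_le zero_le_one] at ht
    exact (hγd t).clog_real (Or.inl (hγpos t ht))
  · refine ContinuousOn.intervalIntegrable fun t ht => ?_
    rw [uIcc_of_le zero_le_one] at ht
    exact (continuousAt_const.div hcont.continuousAt
      (ne_zero_of_re_pos (hγpos t ht))).continuousWithinAt

lemma log_div_of_re_pos {a b : ℂ} (ha : 0 < a.re) (hb : 0 < b.re) :
    Complex.log (a / b) = Complex.log a - Complex.log b := by
  have ha' := abs_lt.1 (Complex.abs_arg_lt_pi_div_two_iff.2 (Or.inl ha))
  have hb' := abs_lt.1 (Complex.abs_arg_lt_pi_div_two_iff.2 (Or.inl hb))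
  have hb0 := ne_zero_of_re_pos hb
  rw [div_eq_mul_inv, (Complex.log_mul_eq_add_log_iff (ne_zero_of_re_pos ha)
    (inv_ne_zero hb0)).2, Complex.log_inv _ (by linarith [Real.pi_pos]), sub_eq_add_neg]
  rw [Complex.arg_inv, if_neg (by linarith [Real.pi_pos])]
  constructor <;> linarith

lemma integral_one_div_sq_sub_one_div_sinh {a : ℂ} (ha : 0 < a.re) :
    ∫ y in Ioi (0 : ℝ), (1 / (a * (y : ℂ) ^ 2) - 1 / ((y : ℂ) * Complex.sinh (a * (y : ℂ)))) =
      Complex.log 2 := by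
  have ha2 : 0 < (a / 2).re := by simpa using ha
  have h0 := ne_zero_of_re_pos ha
  have hlog := integral_langevin_sub_div ha ha2
  rw [← log_div_of_re_pos ha ha2, div_div_cancel₀ h0] at hlog
  rw [← hlog]
  refine setIntegral_congr_fun measurableSet_Ioi fun y hy => ?_
  have hy0 : (y : ℂ) ≠ 0 := by exact_mod_cast (ne_of_gt hy)
  have hs := sinh_ne_zero_of_re_pos (re_mul_ofReal_pos ha hy)
  have e : a / 2 * y = a * y / 2 := by ring
  rw [e, langevin_sub_langevin_half (re_mul_ofReal_pos ha hy)]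
  field_simp

lemma exp_half_log_two : Complex.exp (1 / 2 * Complex.log 2) = (Real.sqrt 2 : ℂ) := by
  rw [Real.sqrt_eq_rpow, Complex.ofReal_cpow (by norm_num),
    Complex.cpow_def_of_ne_zero (by norm_num)]
  push_cast
  ring_nf

lemma exp_half_integral_one_div_sq_sub_one_div_sinh {a : ℂ} (ha : 0 < a.re) :
    Complex.exp ((1 / 2) * ∫ y in Ioi (0 : ℝ),
      (1 / (a * (y : ℂ) ^ 2) - 1 / ((y : ℂ) * Complex.sinh (a * (y : ℂ))))) =
      (Real.sqrt 2 : ℂ) := by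
  rw [integral_one_div_sq_sub_one_div_sinh ha, exp_half_log_two]

lemma hypGammaInt_comm_s13 (a b z : ℂ) : hypGammaInt a b z = hypGammaInt b a z := by
  simp only [hypGammaInt, mul_comm a b, mul_right_comm _ (Complex.sinh (a * _))]

lemma hypGammaInt_I_mul_half {a b : ℂ} (ha : 0 < a.re) (hb : 0 < b.re) :
    hypGammaInt a b (Complex.I * a / 2) = (Real.sqrt 2 : ℂ) := by
  rw [← exp_half_integral_one_div_sq_sub_one_div_sinh hb, hypGammaInt,
    ← integral_const_mul, ← integral_const_mul]
  congr 1
  refine setIntegral_congr_fun measurableSet_Ioi fun y hy => ?_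
  have hy0 : (y : ℂ) ≠ 0 := by exact_mod_cast (ne_of_gt hy)
  have hs := sinh_ne_zero_of_re_pos (re_mul_ofReal_pos ha hy)
  have hs' := sinh_ne_zero_of_re_pos (re_mul_ofReal_pos hb hy)
  have ha0 := ne_zero_of_re_pos ha
  have hb0 := ne_zero_of_re_pos hb
  have e : 2 * (y : ℂ) * (Complex.I * a / 2) = a * y * Complex.I := by ring
  rw [e, Complex.sin_mul_I]
  generalize Complex.sinh (a * y) = s at *
  generalize Complex.sinh (b * y) = s' at *
  field_simp
  rw [Complex.I_sq]
  ring

lemma hypGammaInt_I_mul_sub_half {a b : ℂ} (ha : 0 < a.re) (hb : 0 < b.re) :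
    hypGammaInt a b (Complex.I * (b - a) / 2) = (b / a) ^ ((1 : ℂ) / 2) := by
  have ha0 := ne_zero_of_re_pos ha
  have hb0 := ne_zero_of_re_pos hb
  rw [Complex.cpow_def_of_ne_zero (div_ne_zero hb0 ha0), log_div_of_re_pos hb ha,
    ← integral_langevin_sub_div hb ha, hypGammaInt, ← integral_const_mul, ← integral_mul_const]
  congr 1
  refine setIntegral_congr_fun measurableSet_Ioi fun y hy => ?_
  have hy0 : (y : ℂ) ≠ 0 := by exact_mod_cast (ne_of_gt hy)
  have hs := sinh_ne_zero_of_re_pos (re_mul_ofReal_pos ha hy)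
  have hs' := sinh_ne_zero_of_re_pos (re_mul_ofReal_pos hb hy)
  have e : 2 * (y : ℂ) * (Complex.I * (b - a) / 2) = (b * y - a * y) * Complex.I := by ring
  simp only [langevin]
  rw [e, Complex.sin_mul_I, Complex.sinh_sub]
  generalize Complex.sinh (a * y) = s at *
  generalize Complex.sinh (b * y) = s' at *
  field_simp
  rw [Complex.I_sq]
  ring

/-- **Special values** of the hyperbolic gamma function: `G(i(ω₋-ω₊)/2) = √(ω₋/ω₊)` and
`G(iω₊/2) = G(iω₋/2) = √2`; equivalently
`exp((1/2)∫₀^∞ (1/(ω∓y²) - 1/(y sinh(ω∓y))) dy) = √2`. -/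
theorem hypGamma_special_values (op om : ℂ) (hop : 0 < op.re) (hom : 0 < om.re) :
    hypGammaInt op om (Complex.I*(om - op)/2) = (om/op) ^ ((1:ℂ)/2) ∧
    hypGammaInt op om (Complex.I*op/2) = (Real.sqrt 2 : ℂ) ∧
    hypGammaInt op om (Complex.I*om/2) = (Real.sqrt 2 : ℂ) ∧
    Complex.exp ((1/2) * ∫ y in Set.Ioi (0:ℝ),
      (1/(om*(y:ℂ)^2) - 1/((y:ℂ)*Complex.sinh (om*(y:ℂ))))) = (Real.sqrt 2 : ℂ) ∧
    Complex.exp ((1/2) * ∫ y in Set.Ioi (0:ℝ),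
      (1/(op*(y:ℂ)^2) - 1/((y:ℂ)*Complex.sinh (op*(y:ℂ))))) = (Real.sqrt 2 : ℂ) := by
  refine ⟨hypGammaInt_I_mul_sub_half hop hom, hypGammaInt_I_mul_half hop hom, ?_,
    exp_half_integral_one_div_sq_sub_one_div_sinh hom,
    exp_half_integral_one_div_sq_sub_one_div_sinh hop⟩
  rw [hypGammaInt_comm_s13, hypGammaInt_I_mul_half hom hop]

end
end
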